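/- arXiv:2604.08328 — 4 statements merged into one kernel-verified Lean document; each statement's English description precedes it below -/
import Mathlib

section
/- (Corollary 1) Consider the noise-free case of the setup in Theorem 1: the system evolves as x_{k+1} = A x_k + B u_k, y_k = C x_k (all process, measurement and state-measurement noises identically zero), so that the offline data are exact and, under the full-row-rank condition on D, the learned parameters satisfy G* = G, H* = H, F* = F and Φ_{*,1}^† Φ_{*,2} = A, Φ_{*,1}^† Φ_{*,3} = B. Then the DDMHE error obeys the linear recursion e_{t−L} = α₁ Λ* Φ_{*,1}^† Φ_{*,2} e_{t−L−1}, and if c₁ = α σ_ν² ‖Λ* Φ_{*,1}^† Φ_{*,2}‖₂ satisfies 0 < c₁ < 1, then lim_{t→∞} ‖e_{t−L}‖₂ = 0, i.e., the estimation error converges asymptotically to zero. -/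
open MeasureTheory ProbabilityTheory Matrix Filter

/-- The spectral norm (largest singular value) of a real matrix. -/
noncomputable def specNorm {m n : Type*} [Fintype m] [Fintype n] [DecidableEq n]
    (M : Matrix m n ℝ) : ℝ :=
  ‖(Matrix.toEuclideanLin.trans LinearMap.toContinuousLinearMap) M‖

/-- The Euclidean norm of a real vector. -/
noncomputable def vecNorm {ι : Type*} [Fintype ι] (v : ι → ℝ) : ℝ :=
  Real.sqrt (∑ i, v i ^ 2)

/-- The smallest eigenvalue of a symmetric positive semidefinite real matrix, characterized
via the Rayleigh quotient as the infimum of `vᵀ S v` over unit vectors `v`. -/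
noncomputable def lambdaMin {n : Type*} [Fintype n] (S : Matrix n n ℝ) : ℝ :=
  ⨅ v : {v : n → ℝ // vecNorm v = 1}, dotProduct (v : n → ℝ) (S.mulVec (v : n → ℝ))

/-- The Gaussian distribution `N(0, σ² I_d)` on `ι → ℝ`: i.i.d. mean-zero real Gaussian
coordinates with variance `σ²`. -/
noncomputable def gaussianPi (ι : Type*) [Fintype ι] (σ : ℝ) : Measure (ι → ℝ) :=
  Measure.pi fun _ => gaussianReal 0 (Real.toNNReal (σ ^ 2))

/-- The extended observability matrix `G ∈ ℝ^{(L+1)p × n}` with block rows `C, CA, …, CA^L`. -/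
def obsG (L : ℕ) {n p : ℕ} (A : Matrix (Fin n) (Fin n) ℝ) (C : Matrix (Fin p) (Fin n) ℝ) :
    Matrix (Fin (L+1) × Fin p) (Fin n) ℝ :=
  fun ri j => (C * A ^ (ri.1 : ℕ)) ri.2 j

/-- The block lower-triangular matrix built from a `(L+1)p × n` matrix `G`: for
`h = 1,…,L` (here `h = hj.1 + 1` with `hj.1 : Fin L`), block rows `h,…,L` of block
column `h` are filled with rows `1,…,(L+1−h)p` of `G`; all other entries are zero.
Applied to the true observability matrix it yields the impulse-response matrix `F`,
and applied to the estimate `G*` it yields `F*` of Algorithm 1. -/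
def buildF (L : ℕ) {n p : ℕ} (G : Matrix (Fin (L+1) × Fin p) (Fin n) ℝ) :
    Matrix (Fin (L+1) × Fin p) (Fin L × Fin n) ℝ :=
  fun ri hj =>
    if _hle : (hj.1 : ℕ) + 1 ≤ (ri.1 : ℕ) then
      G (⟨(ri.1 : ℕ) - (hj.1 : ℕ) - 1, lt_of_le_of_lt (by omega) ri.1.isLt⟩, ri.2) hj.2
    else 0

/-- The Kronecker product `I_L ⊗ B`. -/
def kronIB (L : ℕ) {n m : ℕ} (B : Matrix (Fin n) (Fin m) ℝ) :
    Matrix (Fin L × Fin n) (Fin L × Fin m) ℝ :=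
  fun aj bk => if aj.1 = bk.1 then B aj.2 bk.2 else 0

/-- The matrix `H = F (I_L ⊗ B)`. -/
noncomputable def impH (L : ℕ) {n m p : ℕ} (A : Matrix (Fin n) (Fin n) ℝ)
    (B : Matrix (Fin n) (Fin m) ℝ) (C : Matrix (Fin p) (Fin n) ℝ) :
    Matrix (Fin (L+1) × Fin p) (Fin L × Fin m) ℝ :=
  buildF L (obsG L A C) * kronIB L B

/-- Observability of the pair `(C, A)`: the standard observability matrix
(with block rows `C, CA, …, CA^{n-1}`) has full column rank `n`. -/
def Observable {n p : ℕ} (A : Matrix (Fin n) (Fin n) ℝ)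
    (C : Matrix (Fin p) (Fin n) ℝ) : Prop :=
  (Matrix.of fun (k : Fin n × Fin p) (j : Fin n) => (C * A ^ (k.1 : ℕ)) k.2 j).rank = n

/-- The least-squares estimate `[G*, H*] = Yᵖ Dᵀ (D Dᵀ)⁻¹` with `D = [X̄₀ᵖ; Uᵖ]`. -/
noncomputable def GHstar {N n m p L : ℕ} (Y : Matrix (Fin (L+1) × Fin p) (Fin N) ℝ)
    (X : Matrix (Fin n) (Fin N) ℝ) (U : Matrix (Fin L × Fin m) (Fin N) ℝ) :
    Matrix (Fin (L+1) × Fin p) ((Fin n) ⊕ (Fin L × Fin m)) ℝ :=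
  Y * (fromRows X U)ᵀ * (fromRows X U * (fromRows X U)ᵀ)⁻¹

/-- Rows `1..Lp` (block rows `0,…,L−1`) of a `(L+1)p × n` matrix. -/
def Phi1 {L n p : ℕ} (G : Matrix (Fin (L+1) × Fin p) (Fin n) ℝ) :
    Matrix (Fin L × Fin p) (Fin n) ℝ :=
  G.submatrix (fun ri => (Fin.castSucc ri.1, ri.2)) id

/-- Rows `p+1..(L+1)p` (block rows `1,…,L`) of a `(L+1)p × n` matrix. -/
def Phi2 {L n p : ℕ} (G : Matrix (Fin (L+1) × Fin p) (Fin n) ℝ) :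
    Matrix (Fin L × Fin p) (Fin n) ℝ :=
  G.submatrix (fun ri => (Fin.succ ri.1, ri.2)) id

/-- The first `m` columns of rows `p+1..(L+1)p` of a `(L+1)p × Lm` matrix. -/
def Phi3 {L m p : ℕ} (hL : 0 < L) (H : Matrix (Fin (L+1) × Fin p) (Fin L × Fin m) ℝ) :
    Matrix (Fin L × Fin p) (Fin m) ℝ :=
  H.submatrix (fun ri => (Fin.succ ri.1, ri.2)) (fun j => ((⟨0, hL⟩ : Fin L), j))

/-- The estimate of `A`: `Φ_{*,1}^† Φ_{*,2}` with `Φ_{*,1}^† = (Φ_{*,1}ᵀ Φ_{*,1})⁻¹ Φ_{*,1}ᵀ`. -/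
noncomputable def Astar {L n p : ℕ} (Gs : Matrix (Fin (L+1) × Fin p) (Fin n) ℝ) :
    Matrix (Fin n) (Fin n) ℝ :=
  ((Phi1 Gs)ᵀ * Phi1 Gs)⁻¹ * (Phi1 Gs)ᵀ * Phi2 Gs

/-- The estimate of `B`: `Φ_{*,1}^† Φ_{*,3}`. -/
noncomputable def Bstar {L n m p : ℕ} (hL : 0 < L) (Gs : Matrix (Fin (L+1) × Fin p) (Fin n) ℝ)
    (Hs : Matrix (Fin (L+1) × Fin p) (Fin L × Fin m) ℝ) :
    Matrix (Fin n) (Fin m) ℝ :=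
  ((Phi1 Gs)ᵀ * Phi1 Gs)⁻¹ * (Phi1 Gs)ᵀ * Phi3 hL Hs

/-- The gain matrix `Γ = α₂ Gᵀ (α₂ I + F Fᵀ)⁻¹`. -/
noncomputable def gainGamma {L n p : ℕ} (α₂ : ℝ) (Gs : Matrix (Fin (L+1) × Fin p) (Fin n) ℝ)
    (Fs : Matrix (Fin (L+1) × Fin p) (Fin L × Fin n) ℝ) :
    Matrix (Fin n) (Fin (L+1) × Fin p) ℝ :=
  α₂ • (Gsᵀ * (α₂ • (1 : Matrix (Fin (L+1) × Fin p) (Fin (L+1) × Fin p) ℝ) + Fs * Fsᵀ)⁻¹)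

/-- The normalization matrix `Λ = (α₁ I + Γ G)⁻¹`. -/
noncomputable def lamLambda {L n p : ℕ} (α₁ α₂ : ℝ)
    (Gs : Matrix (Fin (L+1) × Fin p) (Fin n) ℝ)
    (Fs : Matrix (Fin (L+1) × Fin p) (Fin L × Fin n) ℝ) :
    Matrix (Fin n) (Fin n) ℝ :=
  (α₁ • (1 : Matrix (Fin n) (Fin n) ℝ) + gainGamma α₂ Gs Fs * Gs)⁻¹

/-- Tags for the five random objects of each offline data segment:
initial-state measurement, state-measurement noise, input, process noise,
and measurement noise. -/
inductive DTag : Type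
  | xb | chi | inp | pro | mea

/-- The value space of each offline random object. -/
def DType (n m p L : ℕ) : DTag → Type
  | .xb => Fin n → ℝ
  | .chi => Fin n → ℝ
  | .inp => Fin L × Fin m → ℝ
  | .pro => Fin L × Fin n → ℝ
  | .mea => Fin (L+1) × Fin p → ℝ

instance DType.instMeasurableSpace (n m p L : ℕ) (t : DTag) :
    MeasurableSpace (DType n m p L t) :=
  match t with
  | .xb => inferInstanceAs (MeasurableSpace (Fin n → ℝ))
  | .chi => inferInstanceAs (MeasurableSpace (Fin n → ℝ))
  | .inp => inferInstanceAs (MeasurableSpace (Fin L × Fin m → ℝ))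
  | .pro => inferInstanceAs (MeasurableSpace (Fin L × Fin n → ℝ))
  | .mea => inferInstanceAs (MeasurableSpace (Fin (L+1) × Fin p → ℝ))

/-- The family of all offline random objects, indexed by segment and tag. -/
def offFam {Ω : Type*} {N n m p L : ℕ}
    (xb ch : Ω → Fin N → Fin n → ℝ) (uP : Ω → Fin N → Fin L × Fin m → ℝ)
    (wP : Ω → Fin N → Fin L × Fin n → ℝ) (vP : Ω → Fin N → Fin (L+1) × Fin p → ℝ) :
    ∀ i : Fin N × DTag, Ω → DType n m p L i.2 :=
  fun i => match i with
  | (j, .xb) => fun ω => xb ω j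
  | (j, .chi) => fun ω => ch ω j
  | (j, .inp) => fun ω => uP ω j
  | (j, .pro) => fun ω => wP ω j
  | (j, .mea) => fun ω => vP ω j

/-- The threshold `ε₀ = √(‖Φ₁‖₂² + λ_min(Φ₁ᵀΦ₁)) − ‖Φ₁‖₂`, where `Φ₁` consists of the
first `Lp` rows of the true extended observability matrix `G`. -/
noncomputable def eps0 (L : ℕ) {n p : ℕ} (A : Matrix (Fin n) (Fin n) ℝ)
    (C : Matrix (Fin p) (Fin n) ℝ) : ℝ :=
  Real.sqrt (specNorm (Phi1 (obsG L A C)) ^ 2 +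
    lambdaMin ((Phi1 (obsG L A C))ᵀ * Phi1 (obsG L A C))) -
    specNorm (Phi1 (obsG L A C))

/-- `M₀ = 48 L σ_max² σ_min⁻² (‖F‖₂ + ‖G‖₂ + 1)`. -/
noncomputable def M0const (L : ℕ) {n p : ℕ} (A : Matrix (Fin n) (Fin n) ℝ)
    (C : Matrix (Fin p) (Fin n) ℝ) (σω σν σu σx σχ : ℝ) : ℝ :=
  48 * L * (max σω (max σν (max σu (max σx σχ)))) ^ 2 / (min σu σx) ^ 2 *
    (specNorm (buildF L (obsG L A C)) + specNorm (obsG L A C) + 1)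

/-- `M₁(ε) = (‖A‖₂ + ‖B‖₂ + 2)/√(λ_min(Φ₁ᵀΦ₁) − ε² − 2ε‖Φ₁‖₂)`. -/
noncomputable def M1const (L : ℕ) {n m p : ℕ} (A : Matrix (Fin n) (Fin n) ℝ)
    (B : Matrix (Fin n) (Fin m) ℝ) (C : Matrix (Fin p) (Fin n) ℝ) (ε : ℝ) : ℝ :=
  (specNorm A + specNorm B + 2) /
    Real.sqrt (lambdaMin ((Phi1 (obsG L A C))ᵀ * Phi1 (obsG L A C)) - ε ^ 2 -
      2 * ε * specNorm (Phi1 (obsG L A C)))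

/-- `N₀(ε,θ) = 16L² + [16L² + (M₁(ε)² + 1) M₀²/ε²]·log(324/θ)`. -/
noncomputable def N0const (L : ℕ) {n m p : ℕ} (A : Matrix (Fin n) (Fin n) ℝ)
    (B : Matrix (Fin n) (Fin m) ℝ) (C : Matrix (Fin p) (Fin n) ℝ)
    (σω σν σu σx σχ ε θ : ℝ) : ℝ :=
  16 * L ^ 2 + (16 * L ^ 2 +
    (M1const L A B C ε ^ 2 + 1) * M0const L A C σω σν σu σx σχ ^ 2 / ε ^ 2) *
    Real.log (324 / θ)

/-- The moving-horizon prior sequence `x̄_s`: starting from the given prior `xbar0`, it is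
updated via `x̄_{s+1} = As x̂_{s|s+L} + Bs u_s`, where
`x̂_{s|s+L} = Λ (α₁ x̄_s + Γ (y_{[s,s+L]} − H u_{[s,s+L−1]}))`. -/
noncomputable def mhePrior {n m p L : ℕ}
    (Λs : Matrix (Fin n) (Fin n) ℝ) (Γs : Matrix (Fin n) (Fin (L+1) × Fin p) ℝ)
    (Hs : Matrix (Fin (L+1) × Fin p) (Fin L × Fin m) ℝ)
    (As : Matrix (Fin n) (Fin n) ℝ) (Bs : Matrix (Fin n) (Fin m) ℝ)
    (α₁ : ℝ) (ywin : ℕ → Fin (L+1) × Fin p → ℝ) (uwin : ℕ → Fin L × Fin m → ℝ)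
    (uvec : ℕ → Fin m → ℝ) (xbar0 : Fin n → ℝ) : ℕ → Fin n → ℝ
  | 0 => xbar0
  | s + 1 =>
      As.mulVec (Λs.mulVec (α₁ • mhePrior Λs Γs Hs As Bs α₁ ywin uwin uvec xbar0 s +
        Γs.mulVec (ywin s - Hs.mulVec (uwin s)))) + Bs.mulVec (uvec s)

/-- The moving-horizon posterior estimate `x̂_{s|s+L} = Λ (α₁ x̄_s + Γ (y_{[s,s+L]} − H u_{[s,s+L−1]}))`. -/
noncomputable def mheEst {n m p L : ℕ}
    (Λs : Matrix (Fin n) (Fin n) ℝ) (Γs : Matrix (Fin n) (Fin (L+1) × Fin p) ℝ)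
    (Hs : Matrix (Fin (L+1) × Fin p) (Fin L × Fin m) ℝ)
    (As : Matrix (Fin n) (Fin n) ℝ) (Bs : Matrix (Fin n) (Fin m) ℝ)
    (α₁ : ℝ) (ywin : ℕ → Fin (L+1) × Fin p → ℝ) (uwin : ℕ → Fin L × Fin m → ℝ)
    (uvec : ℕ → Fin m → ℝ) (xbar0 : Fin n → ℝ) (s : ℕ) : Fin n → ℝ :=
  Λs.mulVec (α₁ • mhePrior Λs Γs Hs As Bs α₁ ywin uwin uvec xbar0 s +
    Γs.mulVec (ywin s - Hs.mulVec (uwin s)))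

theorem GHstar_of_exact {N n m p L : ℕ} (G : Matrix (Fin (L+1) × Fin p) (Fin n) ℝ)
    (H : Matrix (Fin (L+1) × Fin p) (Fin L × Fin m) ℝ)
    (X : Matrix (Fin n) (Fin N) ℝ) (U : Matrix (Fin L × Fin m) (Fin N) ℝ)
    (hrank : IsUnit (fromRows X U * (fromRows X U)ᵀ).det) :
    GHstar (G * X + H * U) X U = fromCols G H := by
  rw [GHstar, ← fromCols_mul_fromRows, Matrix.mul_assoc (fromCols G H),
    Matrix.mul_nonsing_inv_cancel_right _ _ hrank]

theorem Phi2_obsG (L : ℕ) {n p : ℕ} (A : Matrix (Fin n) (Fin n) ℝ)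
    (C : Matrix (Fin p) (Fin n) ℝ) :
    Phi2 (obsG L A C) = Phi1 (obsG L A C) * A := by
  ext ⟨i, a⟩ j
  have h : Phi2 (obsG L A C) (i, a) j = (C * A ^ (i : ℕ) * A) a j := by
    simp [Phi2, obsG, pow_succ, Matrix.mul_assoc]
  rw [h]
  simp [Phi1, obsG, Matrix.mul_apply (M := C * A ^ (i : ℕ)), Matrix.mul_apply (N := A)]

theorem impH_apply (L : ℕ) {n m p : ℕ} (A : Matrix (Fin n) (Fin n) ℝ)
    (B : Matrix (Fin n) (Fin m) ℝ) (C : Matrix (Fin p) (Fin n) ℝ)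
    (i : Fin (L+1)) (a : Fin p) (h : Fin L) (k : Fin m) :
    impH L A B C (i, a) (h, k) =
      if (h : ℕ) + 1 ≤ (i : ℕ) then (C * A ^ ((i : ℕ) - h - 1) * B) a k else 0 := by
  rw [impH, Matrix.mul_apply, Fintype.sum_prod_type]
  rw [Finset.sum_eq_single h]
  · split_ifs with hle
    · simp [buildF, kronIB, hle, obsG, Matrix.mul_apply (N := B)]
    · simp [buildF, kronIB, hle]
  · intro b _ hb
    simp [kronIB, hb]
  · simp

theorem Phi3_impH {L n m p : ℕ} (hL : 0 < L) (A : Matrix (Fin n) (Fin n) ℝ)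
    (B : Matrix (Fin n) (Fin m) ℝ) (C : Matrix (Fin p) (Fin n) ℝ) :
    Phi3 hL (impH L A B C) = Phi1 (obsG L A C) * B := by
  ext ⟨i, a⟩ j
  have h : Phi3 hL (impH L A B C) (i, a) j = (C * A ^ (i : ℕ) * B) a j := by
    simp [Phi3, impH_apply]
  rw [h]
  simp [Phi1, obsG, Matrix.mul_apply (N := B)]

theorem Observable.mulVec_Phi1_injective {L n p : ℕ} (hnL : n ≤ L)
    {A : Matrix (Fin n) (Fin n) ℝ} {C : Matrix (Fin p) (Fin n) ℝ} (hobs : Observable A C) :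
    Function.Injective (Phi1 (obsG L A C)).mulVec := by
  set O : Matrix (Fin n × Fin p) (Fin n) ℝ :=
    Matrix.of fun (k : Fin n × Fin p) (j : Fin n) => (C * A ^ (k.1 : ℕ)) k.2 j with hO
  have hinj : Function.Injective O.mulVec := by
    rw [Matrix.mulVec_injective_iff]
    rw [linearIndependent_iff_card_eq_finrank_span, Fintype.card_fin, Set.finrank,
      ← Matrix.rank_eq_finrank_span_cols]
    exact hobs.symm
  intro v w hvw
  apply hinj
  ext ⟨i, a⟩
  exact congrFun hvw (Fin.castLE hnL i, a)

theorem Observable.isUnit_det {L n p : ℕ} (hnL : n ≤ L)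
    {A : Matrix (Fin n) (Fin n) ℝ} {C : Matrix (Fin p) (Fin n) ℝ} (hobs : Observable A C) :
    IsUnit ((Phi1 (obsG L A C))ᵀ * Phi1 (obsG L A C)).det := by
  have h := Matrix.PosDef.conjTranspose_mul_self _ (hobs.mulVec_Phi1_injective hnL)
  rw [Matrix.conjTranspose_eq_transpose_of_trivial] at h
  exact h.det_pos.ne'.isUnit

theorem Astar_obsG {L n p : ℕ} (hnL : n ≤ L)
    {A : Matrix (Fin n) (Fin n) ℝ} {C : Matrix (Fin p) (Fin n) ℝ} (hobs : Observable A C) :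
    Astar (obsG L A C) = A := by
  rw [Astar, Phi2_obsG, Matrix.mul_assoc, ← Matrix.mul_assoc _ _ A,
    Matrix.nonsing_inv_mul_cancel_left _ _ (hobs.isUnit_det hnL)]

theorem Bstar_obsG {L n m p : ℕ} (hL : 0 < L) (hnL : n ≤ L)
    {A : Matrix (Fin n) (Fin n) ℝ} (B : Matrix (Fin n) (Fin m) ℝ)
    {C : Matrix (Fin p) (Fin n) ℝ} (hobs : Observable A C) :
    Bstar hL (obsG L A C) (impH L A B C) = B := by
  rw [Bstar, Phi3_impH, Matrix.mul_assoc, ← Matrix.mul_assoc _ _ B,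
    Matrix.nonsing_inv_mul_cancel_left _ _ (hobs.isUnit_det hnL)]

theorem isUnit_det_normalization {L n p : ℕ} {α₁ α₂ : ℝ} (h₁ : 0 < α₁) (h₂ : 0 < α₂)
    (G : Matrix (Fin (L+1) × Fin p) (Fin n) ℝ)
    (F : Matrix (Fin (L+1) × Fin p) (Fin L × Fin n) ℝ) :
    IsUnit (α₁ • (1 : Matrix (Fin n) (Fin n) ℝ) + gainGamma α₂ G F * G).det := by
  have hF : (F * Fᵀ).PosSemidef := by
    simpa using Matrix.posSemidef_self_mul_conjTranspose F
  have hS := ((Matrix.PosDef.one.smul h₂).add_posSemidef hF).inv.posSemidef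
  have hG := (hS.conjTranspose_mul_mul_same G).smul h₂.le
  rw [Matrix.conjTranspose_eq_transpose_of_trivial] at hG
  rw [gainGamma, Matrix.smul_mul]
  exact ((Matrix.PosDef.one.smul h₁).add_posSemidef hG).det_pos.ne'.isUnit

theorem state_eq_sum {n m : ℕ} {A : Matrix (Fin n) (Fin n) ℝ}
    {B : Matrix (Fin n) (Fin m) ℝ} {x : ℕ → Fin n → ℝ} {u : ℕ → Fin m → ℝ}
    (hdyn : ∀ k, x (k+1) = A.mulVec (x k) + B.mulVec (u k)) (s i : ℕ) :
    x (s + i) = (A ^ i).mulVec (x s) +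
      ∑ h ∈ Finset.range i, (A ^ (i - h - 1) * B).mulVec (u (s + h)) := by
  induction i with
  | zero => simp
  | succ i ih =>
    rw [← add_assoc, hdyn, ih, Finset.sum_range_succ, Matrix.mulVec_add, Matrix.mulVec_mulVec,
      ← pow_succ', Matrix.mulVec_sum, add_assoc]
    congr 2
    · refine Finset.sum_congr rfl fun h hh => ?_
      have hlt := Finset.mem_range.mp hh
      rw [Matrix.mulVec_mulVec, ← Matrix.mul_assoc, ← pow_succ']
      congr 3
      omega
    · simp

theorem impH_mulVec (L : ℕ) {n m p : ℕ} (A : Matrix (Fin n) (Fin n) ℝ)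
    (B : Matrix (Fin n) (Fin m) ℝ) (C : Matrix (Fin p) (Fin n) ℝ) (u : ℕ → Fin m → ℝ)
    (i : Fin (L+1)) (a : Fin p) :
    (impH L A B C).mulVec (fun rj => u (rj.1 : ℕ) rj.2) (i, a) =
      ∑ h ∈ Finset.range i, (C * A ^ ((i : ℕ) - h - 1) * B).mulVec (u h) a := by
  have h1 : (impH L A B C).mulVec (fun rj => u (rj.1 : ℕ) rj.2) (i, a) =
      ∑ h : Fin L, if (h : ℕ) + 1 ≤ (i : ℕ) then
        (C * A ^ ((i : ℕ) - h - 1) * B).mulVec (u h) a else 0 := by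
    rw [Matrix.mulVec, dotProduct, Fintype.sum_prod_type]
    refine Finset.sum_congr rfl fun h _ => ?_
    simp only [impH_apply]
    split_ifs <;> simp [Matrix.mulVec, dotProduct]
  rw [h1, Fin.sum_univ_eq_sum_range (fun h => if h + 1 ≤ (i : ℕ) then
        (C * A ^ ((i : ℕ) - h - 1) * B).mulVec (u h) a else 0) L, ← Finset.sum_filter]
  refine Finset.sum_congr ?_ fun _ _ => rfl
  ext h
  have := i.isLt
  simp only [Finset.mem_filter, Finset.mem_range]
  omega

theorem output_window {L n m p : ℕ} {A : Matrix (Fin n) (Fin n) ℝ}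
    {B : Matrix (Fin n) (Fin m) ℝ} (C : Matrix (Fin p) (Fin n) ℝ)
    {x : ℕ → Fin n → ℝ} {u : ℕ → Fin m → ℝ}
    (hdyn : ∀ k, x (k+1) = A.mulVec (x k) + B.mulVec (u k)) (s : ℕ) :
    (fun ri : Fin (L+1) × Fin p => C.mulVec (x (s + (ri.1 : ℕ))) ri.2) -
      (impH L A B C).mulVec (fun rj => u (s + (rj.1 : ℕ)) rj.2) =
    (obsG L A C).mulVec (x s) := by
  ext ⟨i, a⟩
  rw [Pi.sub_apply, impH_mulVec L A B C (fun h => u (s + h)), sub_eq_iff_eq_add]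
  simp only [state_eq_sum hdyn s i, Matrix.mulVec_add, Matrix.mulVec_sum, Matrix.mulVec_mulVec,
    Pi.add_apply, Finset.sum_apply, Matrix.mul_assoc]
  rfl

theorem mulVec_sub_eq_of_inv {n : ℕ} {M P : Matrix (Fin n) (Fin n) ℝ} {c : ℝ}
    (hP : P = c • (1 : Matrix (Fin n) (Fin n) ℝ) + M) (hdet : IsUnit P.det)
    (v w : Fin n → ℝ) :
    P⁻¹.mulVec (c • v + M.mulVec w) - w = c • P⁻¹.mulVec (v - w) := by
  have hw : w = P⁻¹.mulVec (P.mulVec w) := by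
    rw [Matrix.mulVec_mulVec, Matrix.nonsing_inv_mul _ hdet, Matrix.one_mulVec]
  have hPw : P.mulVec w = c • w + M.mulVec w := by
    rw [hP, Matrix.add_mulVec, Matrix.smul_mulVec, Matrix.one_mulVec]
  calc P⁻¹.mulVec (c • v + M.mulVec w) - w
      = P⁻¹.mulVec (c • v + M.mulVec w) - P⁻¹.mulVec (P.mulVec w) := by rw [← hw]
    _ = c • P⁻¹.mulVec (v - w) := by
      rw [hPw, ← Matrix.mulVec_sub, ← Matrix.mulVec_smul, smul_sub, add_sub_add_right_eq_sub]

theorem vecNorm_eq_norm {ι : Type*} [Fintype ι] (v : ι → ℝ) :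
    vecNorm v = ‖WithLp.toLp 2 v‖ := by
  simp [vecNorm, EuclideanSpace.norm_eq]

theorem vecNorm_mulVec_le {m n : Type*} [Fintype m] [Fintype n] [DecidableEq n]
    (M : Matrix m n ℝ) (v : n → ℝ) :
    vecNorm (M.mulVec v) ≤ specNorm M * vecNorm v := by
  rw [vecNorm_eq_norm, vecNorm_eq_norm]
  exact ((Matrix.toEuclideanLin.trans LinearMap.toContinuousLinearMap) M).le_opNorm
    (WithLp.toLp 2 v)

theorem vecNorm_smul {ι : Type*} [Fintype ι] (c : ℝ) (v : ι → ℝ) :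
    vecNorm (c • v) = |c| * vecNorm v := by
  rw [vecNorm_eq_norm, vecNorm_eq_norm, WithLp.toLp_smul, norm_smul, Real.norm_eq_abs]

theorem tendsto_vecNorm_of_contraction {n : ℕ} {c : ℝ} (hc : 0 ≤ c)
    (M : Matrix (Fin n) (Fin n) ℝ) {e : ℕ → Fin n → ℝ}
    (he : ∀ s, e (s+1) = c • M.mulVec (e s)) (h0 : 0 ≤ c * specNorm M)
    (h1 : c * specNorm M < 1) :
    Tendsto (fun s => vecNorm (e s)) atTop (nhds 0) := by
  have hbound : ∀ s, vecNorm (e s) ≤ (c * specNorm M) ^ s * vecNorm (e 0) := by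
    intro s
    induction s with
    | zero => simp
    | succ s ih =>
      calc vecNorm (e (s+1)) = c * vecNorm (M.mulVec (e s)) := by
            rw [he, vecNorm_smul, abs_of_nonneg hc]
        _ ≤ c * (specNorm M * vecNorm (e s)) := by
            gcongr
            exact vecNorm_mulVec_le M (e s)
        _ = c * specNorm M * vecNorm (e s) := by ring
        _ ≤ c * specNorm M * ((c * specNorm M) ^ s * vecNorm (e 0)) := by gcongr
        _ = (c * specNorm M) ^ (s+1) * vecNorm (e 0) := by ring
  refine squeeze_zero (fun s => Real.sqrt_nonneg _) hbound ?_
  simpa using (tendsto_pow_atTop_nhds_zero_of_lt_one h0 h1).mul_const (vecNorm (e 0))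

theorem stmt6
    (n m p L : ℕ) (hn : 0 < n) (hm : 0 < m) (hp : 0 < p)
    (hnL : n ≤ L) (hmL : m ≤ L) (hpL : p ≤ L)
    (A : Matrix (Fin n) (Fin n) ℝ) (B : Matrix (Fin n) (Fin m) ℝ)
    (C : Matrix (Fin p) (Fin n) ℝ) (hobs : Observable A C)
    -- design parameters of the DDMHE
    (α σω σν : ℝ) (hα : 0 < α) (hσω : 0 < σω) (hσν : 0 < σν)
    -- noise-free offline data: exact initial states X̄₀ᵖ, inputs Uᵖ, and exact outputs
    -- Yᵖ = G X̄₀ᵖ + H Uᵖ, with D = [X̄₀ᵖ; Uᵖ] of full row rank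
    (N : ℕ) (hN : 0 < N)
    (X : Matrix (Fin n) (Fin N) ℝ) (U : Matrix (Fin L × Fin m) (Fin N) ℝ)
    (hrank : IsUnit (fromRows X U * (fromRows X U)ᵀ).det)
    -- noise-free online trajectory: x_{k+1} = A x_k + B u_k, y_k = C x_k
    (x : ℕ → Fin n → ℝ) (u : ℕ → Fin m → ℝ)
    (hdyn : ∀ k, x (k+1) = A.mulVec (x k) + B.mulVec (u k))
    -- the initial prior of the DDMHE
    (xbar0 : Fin n → ℝ) :
    -- the learned parameters coincide with the true ones, the estimation error obeys the
    -- stated linear recursion, and if 0 < c₁ < 1 it converges asymptotically to zero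
    let Y : Matrix (Fin (L+1) × Fin p) (Fin N) ℝ := obsG L A C * X + impH L A B C * U
    let Gs : Matrix (Fin (L+1) × Fin p) (Fin n) ℝ := (GHstar Y X U).submatrix id Sum.inl
    let Hs : Matrix (Fin (L+1) × Fin p) (Fin L × Fin m) ℝ :=
      (GHstar Y X U).submatrix id Sum.inr
    let Fs : Matrix (Fin (L+1) × Fin p) (Fin L × Fin n) ℝ := buildF L Gs
    let α₁ : ℝ := α * σν ^ 2
    let α₂ : ℝ := σν ^ 2 / σω ^ 2
    let Γs : Matrix (Fin n) (Fin (L+1) × Fin p) ℝ := gainGamma α₂ Gs Fs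
    let Λs : Matrix (Fin n) (Fin n) ℝ := lamLambda α₁ α₂ Gs Fs
    let As : Matrix (Fin n) (Fin n) ℝ := Astar Gs
    let Bs : Matrix (Fin n) (Fin m) ℝ := Bstar (hn.trans_le hnL) Gs Hs
    let c₁ : ℝ := α * σν ^ 2 * specNorm (Λs * As)
    -- output and input windows of the noise-free online trajectory
    let ywin : ℕ → Fin (L+1) × Fin p → ℝ := fun s ri => C.mulVec (x (s + (ri.1 : ℕ))) ri.2
    let uwin : ℕ → Fin L × Fin m → ℝ := fun s rj => u (s + (rj.1 : ℕ)) rj.2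
    -- estimation error e_s = x̂_{s|s+L} − x_s
    let e : ℕ → Fin n → ℝ := fun s => mheEst Λs Γs Hs As Bs α₁ ywin uwin u xbar0 s - x s
    Gs = obsG L A C ∧ Hs = impH L A B C ∧ Fs = buildF L (obsG L A C) ∧
      As = A ∧ Bs = B ∧
      (∀ s : ℕ, e (s+1) = α₁ • (Λs * As).mulVec (e s)) ∧
      ((0 < c₁ ∧ c₁ < 1) →
        Filter.Tendsto (fun s : ℕ => vecNorm (e s)) Filter.atTop (nhds 0)) := by
  intro Y Gs Hs Fs α₁ α₂ Γs Λs As Bs c₁ ywin uwin e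
  have hGH : GHstar Y X U = fromCols (obsG L A C) (impH L A B C) :=
    GHstar_of_exact _ _ X U hrank
  have hGs : Gs = obsG L A C := by
    ext i j
    simp [Gs, hGH]
  have hHs : Hs = impH L A B C := by
    ext i j
    simp [Hs, hGH]
  have hAs : As = A := by
    simp only [As, hGs]
    exact Astar_obsG hnL hobs
  have hBs : Bs = B := by
    simp only [Bs, hGs, hHs]
    exact Bstar_obsG _ hnL B hobs
  have h₁ : 0 < α₁ := by positivity
  have h₂ : 0 < α₂ := by positivity
  have herr : ∀ s, e s = α₁ • Λs.mulVec
      (mhePrior Λs Γs Hs As Bs α₁ ywin uwin u xbar0 s - x s) := by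
    intro s
    have hy : ywin s - Hs.mulVec (uwin s) = Gs.mulVec (x s) := by
      rw [hHs, hGs]
      exact output_window C hdyn s
    simp only [e, mheEst]
    rw [hy, Matrix.mulVec_mulVec]
    exact mulVec_sub_eq_of_inv rfl (isUnit_det_normalization h₁ h₂ Gs Fs) _ _
  have hrec : ∀ s, e (s+1) = α₁ • (Λs * As).mulVec (e s) := by
    intro s
    have hprior : mhePrior Λs Γs Hs As Bs α₁ ywin uwin u xbar0 (s+1) - x (s+1) =
        As.mulVec (e s) := by
      have hx : x (s+1) = As.mulVec (x s) + Bs.mulVec (u s) := by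
        rw [hAs, hBs]
        exact hdyn s
      rw [hx]
      simp only [e, mheEst, mhePrior, Matrix.mulVec_sub]
      exact add_sub_add_right_eq_sub _ _ _
    rw [herr (s+1), hprior, Matrix.mulVec_mulVec]
  refine ⟨hGs, hHs, by simp only [Fs, hGs], hAs, hBs, hrec, fun hc => ?_⟩
  exact tendsto_vecNorm_of_contraction h₁.le (Λs * As) hrec hc.1.le hc.2
end

section
/- Let p, n, L be positive integers and let G, G' ∈ ℝ^{(L+1)p×n}. Define the map T : ℝ^{(L+1)p×n} → ℝ^{(L+1)p×Ln} by: for h = 1,…,L, the submatrix of T(G) occupying rows hp+1,…,(L+1)p and columns (h−1)n+1,…,hn equals the submatrix of G occupying rows 1,…,(L+1−h)p (and all n columns), and every other entry of T(G) is zero. Then ‖T(G) − T(G')‖₂ ≤ √L · ‖G − G'‖₂. -/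
open Matrix

/-- The map `T` assembling the block lower-triangular matrix from `G`: for `h = 1,…,L`
(the block column index, here `hj.1 + 1` with `hj.1 : Fin L`), the submatrix occupying
(block) rows `h,…,L` and block column `h` equals rows `1,…,(L+1−h)p` of `G`; all other
entries are zero. -/
def buildT (L p n : ℕ) (G : Matrix (Fin (L+1) × Fin p) (Fin n) ℝ) :
    Matrix (Fin (L+1) × Fin p) (Fin L × Fin n) ℝ :=
  fun ri hj =>
    if _hle : (hj.1 : ℕ) + 1 ≤ (ri.1 : ℕ) then
      G (⟨(ri.1 : ℕ) - (hj.1 : ℕ) - 1, lt_of_le_of_lt (by omega) ri.1.isLt⟩, ri.2) hj.2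
    else 0

theorem buildT_sub (L p n : ℕ) (G G' : Matrix (Fin (L+1) × Fin p) (Fin n) ℝ) :
    buildT L p n G - buildT L p n G' = buildT L p n (G - G') := by
  ext ri hj
  simp only [buildT, Matrix.sub_apply]
  split_ifs <;> simp

theorem specNorm_nonneg {m n : Type*} [Fintype m] [Fintype n] [DecidableEq n]
    (M : Matrix m n ℝ) : 0 ≤ specNorm M :=
  norm_nonneg _

theorem sum_sq_mulVec_le {m n : Type*} [Fintype m] [Fintype n] [DecidableEq n]
    (M : Matrix m n ℝ) (x : n → ℝ) :
    ∑ i, (M *ᵥ x) i ^ 2 ≤ specNorm M ^ 2 * ∑ j, x j ^ 2 := by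
  have h : ‖WithLp.toLp 2 (M *ᵥ x)‖ ≤ specNorm M * ‖WithLp.toLp 2 x‖ :=
    ((Matrix.toEuclideanLin.trans LinearMap.toContinuousLinearMap) M).le_opNorm
      (WithLp.toLp 2 x)
  have h2 := pow_le_pow_left₀ (norm_nonneg _) h 2
  rwa [mul_pow, EuclideanSpace.real_norm_sq_eq, EuclideanSpace.real_norm_sq_eq] at h2

theorem specNorm_le_of_sum_sq_mulVec_le {m n : Type*} [Fintype m] [Fintype n] [DecidableEq n]
    (M : Matrix m n ℝ) {C : ℝ} (hC : 0 ≤ C)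
    (h : ∀ x : n → ℝ, ∑ i, (M *ᵥ x) i ^ 2 ≤ C ^ 2 * ∑ j, x j ^ 2) : specNorm M ≤ C := by
  refine ContinuousLinearMap.opNorm_le_bound _ hC fun x => ?_
  change ‖WithLp.toLp 2 (M *ᵥ x.ofLp)‖ ≤ C * ‖x‖
  refine le_of_sq_le_sq ?_ (by positivity)
  rw [mul_pow, EuclideanSpace.real_norm_sq_eq, EuclideanSpace.real_norm_sq_eq]
  exact h x.ofLp

/-- Shifting a nonnegative sequence down, padding with zeros, does not increase its sum. -/
theorem sum_shift_le (L k : ℕ) (f : Fin (L+1) → ℝ) (hf : ∀ j, 0 ≤ f j) :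
    ∑ i : Fin (L+1), (if k + 1 ≤ (i : ℕ) then
      f ⟨(i : ℕ) - k - 1, lt_of_le_of_lt (by omega) i.isLt⟩ else 0) ≤ ∑ j, f j := by
  rw [← Finset.sum_filter, ← Finset.sum_image (f := f)
    (g := fun i : Fin (L+1) => ⟨(i : ℕ) - k - 1, lt_of_le_of_lt (by omega) i.isLt⟩)]
  · exact Finset.sum_le_sum_of_subset_of_nonneg (Finset.subset_univ _) fun j _ _ => hf j
  · intro i hi j hj hij
    simp only [Finset.coe_filter, Finset.mem_univ, true_and, Set.mem_ofPred_eq] at hi hj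
    simp only [Fin.mk.injEq] at hij
    ext
    omega

theorem buildT_mulVec (L p n : ℕ) (D : Matrix (Fin (L+1) × Fin p) (Fin n) ℝ)
    (x : Fin L × Fin n → ℝ) (i : Fin (L+1)) (a : Fin p) :
    (buildT L p n D *ᵥ x) (i, a) = ∑ h : Fin L, if (h : ℕ) + 1 ≤ (i : ℕ) then
      (D *ᵥ fun b => x (h, b)) (⟨(i : ℕ) - h - 1, lt_of_le_of_lt (by omega) i.isLt⟩, a)
      else 0 := by
  simp only [Matrix.mulVec, dotProduct, Fintype.sum_prod_type, buildT]
  refine Finset.sum_congr rfl fun h _ => ?_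
  split_ifs <;> simp

theorem sum_sq_buildT_mulVec_le (L p n : ℕ) (D : Matrix (Fin (L+1) × Fin p) (Fin n) ℝ)
    (x : Fin L × Fin n → ℝ) :
    ∑ r, (buildT L p n D *ᵥ x) r ^ 2 ≤
      L * ∑ h : Fin L, ∑ r, (D *ᵥ fun b => x (h, b)) r ^ 2 := by
  have key (i : Fin (L+1)) (a : Fin p) : (buildT L p n D *ᵥ x) (i, a) ^ 2 ≤
      L * ∑ h : Fin L, if (h : ℕ) + 1 ≤ (i : ℕ) then
        (D *ᵥ fun b => x (h, b)) (⟨(i : ℕ) - h - 1, lt_of_le_of_lt (by omega) i.isLt⟩, a) ^ 2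
        else 0 := by
    rw [buildT_mulVec]
    refine (sq_sum_le_card_mul_sum_sq).trans_eq ?_
    simp [ite_pow]
  rw [Fintype.sum_prod_type_right]
  refine (Finset.sum_le_sum fun a _ => Finset.sum_le_sum fun i _ => key i a).trans ?_
  simp only [← Finset.mul_sum]
  refine mul_le_mul_of_nonneg_left ?_ (Nat.cast_nonneg L)
  simp only [Fintype.sum_prod_type_right]
  rw [Finset.sum_comm (s := (Finset.univ : Finset (Fin L)))]
  refine Finset.sum_le_sum fun a _ => ?_
  rw [Finset.sum_comm]
  exact Finset.sum_le_sum fun h _ =>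
    sum_shift_le L h (fun j => (D *ᵥ fun b => x (h, b)) (j, a) ^ 2) fun _ => sq_nonneg _

theorem stmt8 (p n L : ℕ) (hp : 0 < p) (hn : 0 < n) (hL : 0 < L)
    (G G' : Matrix (Fin (L+1) × Fin p) (Fin n) ℝ) :
    specNorm (buildT L p n G - buildT L p n G') ≤ Real.sqrt L * specNorm (G - G') := by
  rw [buildT_sub]
  refine specNorm_le_of_sum_sq_mulVec_le _
    (mul_nonneg (Real.sqrt_nonneg _) (specNorm_nonneg _)) fun x => ?_
  refine (sum_sq_buildT_mulVec_le L p n (G - G') x).trans ?_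
  rw [mul_pow, Real.sq_sqrt (Nat.cast_nonneg L), mul_assoc, Fintype.sum_prod_type,
    Finset.mul_sum (s := Finset.univ) (a := specNorm (G - G') ^ 2)]
  exact mul_le_mul_of_nonneg_left
    (Finset.sum_le_sum fun h _ => sum_sq_mulVec_le _ _) (Nat.cast_nonneg L)
end

section
/- Let α₂ > 0, L a positive integer, ε ≥ 0, G, G' ∈ ℝ^{q×n}, F, F' ∈ ℝ^{q×r}, and suppose ‖G − G'‖₂ ≤ ε and ‖F − F'‖₂ ≤ √L ε. Define Γ = α₂ Gᵀ(α₂ I_q + F Fᵀ)⁻¹ and Γ' = α₂ G'ᵀ(α₂ I_q + F' F'ᵀ)⁻¹. Then ‖Γ' − Γ‖₂ ≤ M_Γ ε, where M_Γ = α₂ ‖Gᵀ(α₂ I_q + F' F'ᵀ)⁻¹‖₂ · ‖(α₂ I_q + F Fᵀ)⁻¹‖₂ · (‖F‖₂ + ‖F'‖₂) √L + α₂ ‖(α₂ I_q + F' F'ᵀ)⁻¹‖₂. -/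
open Matrix

section SpectralNorm

open scoped Matrix.Norms.L2Operator

lemma specNorm_eq_norm {m n : Type*} [Fintype m] [Fintype n] [DecidableEq n]
    (M : Matrix m n ℝ) : specNorm M = ‖M‖ := rfl

lemma l2_opNorm_transpose {m n : Type*} [Fintype m] [Fintype n] [DecidableEq m] [DecidableEq n]
    (M : Matrix m n ℝ) : ‖Mᵀ‖ = ‖M‖ := by
  rw [← Matrix.conjTranspose_eq_transpose_of_trivial, Matrix.l2_opNorm_conjTranspose]

lemma l2_opNorm_mul_transpose_sub_le {m n : Type*} [Fintype m] [Fintype n] [DecidableEq m]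
    [DecidableEq n] (F F' : Matrix m n ℝ) :
    ‖F * Fᵀ - F' * F'ᵀ‖ ≤ (‖F‖ + ‖F'‖) * ‖F - F'‖ := by
  have h : F * Fᵀ - F' * F'ᵀ = F * (F - F')ᵀ + (F - F') * F'ᵀ := by
    rw [Matrix.transpose_sub, Matrix.mul_sub, Matrix.sub_mul]
    abel
  calc ‖F * Fᵀ - F' * F'ᵀ‖ = ‖F * (F - F')ᵀ + (F - F') * F'ᵀ‖ := by rw [h]
    _ ≤ ‖F‖ * ‖(F - F')ᵀ‖ + ‖F - F'‖ * ‖F'ᵀ‖ :=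
      norm_add_le_of_le (Matrix.l2_opNorm_mul _ _) (Matrix.l2_opNorm_mul _ _)
    _ = (‖F‖ + ‖F'‖) * ‖F - F'‖ := by
      rw [l2_opNorm_transpose, l2_opNorm_transpose]
      ring

lemma l2_opNorm_transpose_mul_inv_sub_le {m n : Type*} [Fintype m] [Fintype n] [DecidableEq m]
    [DecidableEq n] (G G' : Matrix m n ℝ) {A A' : Matrix m m ℝ} (h : IsUnit A' ↔ IsUnit A) :
    ‖G'ᵀ * A'⁻¹ - Gᵀ * A⁻¹‖ ≤
      ‖Gᵀ * A'⁻¹‖ * ‖A - A'‖ * ‖A⁻¹‖ + ‖G - G'‖ * ‖A'⁻¹‖ := by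
  have key : G'ᵀ * A'⁻¹ - Gᵀ * A⁻¹ = Gᵀ * A'⁻¹ * (A - A') * A⁻¹ - (G - G')ᵀ * A'⁻¹ := by
    rw [Matrix.mul_assoc, Matrix.mul_assoc, ← Matrix.mul_assoc A'⁻¹, ← Matrix.inv_sub_inv h,
      Matrix.transpose_sub, Matrix.mul_sub, Matrix.sub_mul]
    abel
  rw [key, ← l2_opNorm_transpose (G - G')]
  refine norm_sub_le_of_le ((Matrix.l2_opNorm_mul _ _).trans ?_) (Matrix.l2_opNorm_mul _ _)
  gcongr
  exact Matrix.l2_opNorm_mul _ _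

end SpectralNorm

lemma isUnit_smul_one_add_mul_transpose {m n : Type*} [Fintype m] [Fintype n] [DecidableEq m]
    {a : ℝ} (ha : 0 < a) (F : Matrix m n ℝ) : IsUnit (a • (1 : Matrix m m ℝ) + F * Fᵀ) := by
  have hF : (F * Fᵀ).PosSemidef := by
    simpa using Matrix.posSemidef_self_mul_conjTranspose F
  exact ((Matrix.PosDef.one.smul ha).add_posSemidef hF).isUnit

theorem stmt10 (q n r L : ℕ) (hL : 0 < L) (α₂ ε : ℝ) (hα₂ : 0 < α₂) (hε : 0 ≤ ε)
    (G G' : Matrix (Fin q) (Fin n) ℝ) (F F' : Matrix (Fin q) (Fin r) ℝ)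
    (hG : specNorm (G - G') ≤ ε) (hF : specNorm (F - F') ≤ Real.sqrt L * ε) :
    specNorm (α₂ • (G'ᵀ * (α₂ • (1 : Matrix (Fin q) (Fin q) ℝ) + F' * F'ᵀ)⁻¹) -
        α₂ • (Gᵀ * (α₂ • (1 : Matrix (Fin q) (Fin q) ℝ) + F * Fᵀ)⁻¹)) ≤
      (α₂ * (specNorm (Gᵀ * (α₂ • (1 : Matrix (Fin q) (Fin q) ℝ) + F' * F'ᵀ)⁻¹) *
          specNorm ((α₂ • (1 : Matrix (Fin q) (Fin q) ℝ) + F * Fᵀ)⁻¹) *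
          (specNorm F + specNorm F') * Real.sqrt L) +
        α₂ * specNorm ((α₂ • (1 : Matrix (Fin q) (Fin q) ℝ) + F' * F'ᵀ)⁻¹)) * ε := by
  open scoped Matrix.Norms.L2Operator in
  simp only [specNorm_eq_norm] at hG hF ⊢
  have hu : IsUnit (α₂ • (1 : Matrix (Fin q) (Fin q) ℝ) + F' * F'ᵀ) ↔
      IsUnit (α₂ • (1 : Matrix (Fin q) (Fin q) ℝ) + F * Fᵀ) :=
    iff_of_true (isUnit_smul_one_add_mul_transpose hα₂ F')
      (isUnit_smul_one_add_mul_transpose hα₂ F)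
  have hmain := l2_opNorm_transpose_mul_inv_sub_le G G' hu
  rw [add_sub_add_left_eq_sub] at hmain
  have hFF : ‖F * Fᵀ - F' * F'ᵀ‖ ≤ (‖F‖ + ‖F'‖) * (Real.sqrt L * ε) :=
    (l2_opNorm_mul_transpose_sub_le F F').trans (by gcongr)
  rw [← smul_sub, norm_smul, Real.norm_of_nonneg hα₂.le]
  set S := (α₂ • (1 : Matrix (Fin q) (Fin q) ℝ) + F * Fᵀ)⁻¹
  set S' := (α₂ • (1 : Matrix (Fin q) (Fin q) ℝ) + F' * F'ᵀ)⁻¹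
  calc α₂ * ‖G'ᵀ * S' - Gᵀ * S‖
      ≤ α₂ * (‖Gᵀ * S'‖ * ((‖F‖ + ‖F'‖) * (Real.sqrt L * ε)) * ‖S‖ + ε * ‖S'‖) := by
        refine mul_le_mul_of_nonneg_left (hmain.trans ?_) hα₂.le
        gcongr
    _ = _ := by ring
end

section
/- Let q, n, s, r be positive integers, z ∈ ℝ^q, x̄ ∈ ℝⁿ, u ∈ ℝ^s, G* ∈ ℝ^{q×n}, H* ∈ ℝ^{q×s}, F* ∈ ℝ^{q×r}, and α, σ_ω, σ_ν > 0. Set α₁ = α σ_ν², α₂ = σ_ν²/σ_ω², Γ* = α₂ G*ᵀ(α₂ I_q + F* F*ᵀ)⁻¹, and Λ* = (α₁ I_n + Γ* G*)⁻¹. Then the strictly convex quadratic function J(x, ω) = α‖x − x̄‖² + σ_ω⁻²‖ω‖² + σ_ν⁻²‖z − G* x − H* u − F* ω‖² on ℝⁿ × ℝ^r has a unique global minimizer (x̂, ω̂), whose components are given in closed form by x̂ = Λ*(α₁ x̄ + Γ*(z − H* u)) and ω̂ = (α₂ I_r + F*ᵀ F*)⁻¹ F*ᵀ (z − H* u − G*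 x̂). -/
open Matrix

lemma vecNorm_sq {ι : Type*} [Fintype ι] (v : ι → ℝ) : vecNorm v ^ 2 = v ⬝ᵥ v := by
  rw [vecNorm, Real.sq_sqrt (Finset.sum_nonneg fun i _ => sq_nonneg _)]
  simp [dotProduct, sq]

lemma vecNorm_sq_add {ι : Type*} [Fintype ι] (v w : ι → ℝ) :
    vecNorm (v + w) ^ 2 = vecNorm v ^ 2 + 2 * (v ⬝ᵥ w) + vecNorm w ^ 2 := by
  simp only [vecNorm_sq, add_dotProduct, dotProduct_add, dotProduct_comm w v]
  ring

lemma vecNorm_sq_eq_zero {ι : Type*} [Fintype ι] {v : ι → ℝ} : vecNorm v ^ 2 = 0 ↔ v = 0 := by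
  rw [vecNorm_sq, dotProduct_self_eq_zero]

/-- A regularized least-squares cost, expanded around a solution of its normal equations. -/
lemma cost_eq_of_normal_equations {m n r : Type*} [Fintype m] [Fintype n] [Fintype r]
    (G : Matrix m n ℝ) (F : Matrix m r ℝ) (y : m → ℝ) (c x₀ x : n → ℝ) (w₀ w : r → ℝ)
    (a b γ : ℝ) (hx : a • (x₀ - c) = γ • Gᵀ *ᵥ (y - G *ᵥ x₀ - F *ᵥ w₀))
    (hw : b • w₀ = γ • Fᵀ *ᵥ (y - G *ᵥ x₀ - F *ᵥ w₀)) :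
    a * vecNorm (x - c) ^ 2 + b * vecNorm w ^ 2 + γ * vecNorm (y - G *ᵥ x - F *ᵥ w) ^ 2 =
      a * vecNorm (x₀ - c) ^ 2 + b * vecNorm w₀ ^ 2 +
        γ * vecNorm (y - G *ᵥ x₀ - F *ᵥ w₀) ^ 2 +
      (a * vecNorm (x - x₀) ^ 2 + b * vecNorm (w - w₀) ^ 2 +
        γ * vecNorm (-(G *ᵥ (x - x₀) + F *ᵥ (w - w₀))) ^ 2) := by
  have e1 : x - c = (x₀ - c) + (x - x₀) := by abel
  have e2 : w = w₀ + (w - w₀) := by abel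
  have e3 : y - G *ᵥ x - F *ᵥ w =
      (y - G *ᵥ x₀ - F *ᵥ w₀) + -(G *ᵥ (x - x₀) + F *ᵥ (w - w₀)) := by
    simp only [mulVec_sub]; abel
  have h1 := congrArg (· ⬝ᵥ (x - x₀)) hx
  have h2 := congrArg (· ⬝ᵥ (w - w₀)) hw
  simp only [smul_dotProduct, mulVec_transpose, ← dotProduct_mulVec, smul_eq_mul] at h1 h2
  rw [e3, vecNorm_sq_add, e1, vecNorm_sq_add]
  conv_lhs => rw [e2]
  rw [vecNorm_sq_add]
  simp only [add_sub_cancel_left, dotProduct_neg, dotProduct_add]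
  linear_combination 2 * h1 + 2 * h2

lemma posDef_smul_one_add {m : Type*} [Fintype m] [DecidableEq m] {c : ℝ} (hc : 0 < c)
    {A : Matrix m m ℝ} (hA : A.PosSemidef) : (c • (1 : Matrix m m ℝ) + A).PosDef :=
  ((PosDef.one : (1 : Matrix m m ℝ).PosDef).smul hc).add_posSemidef hA

lemma Matrix.PosDef.mul_inv_mulVec {m : Type*} [Fintype m] [DecidableEq m]
    {A : Matrix m m ℝ} (hA : A.PosDef) (v : m → ℝ) : A *ᵥ (A⁻¹ *ᵥ v) = v := by
  rw [mulVec_mulVec, mul_nonsing_inv _ ((isUnit_iff_isUnit_det A).mp hA.isUnit), one_mulVec]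

/-- The residual of ridge regression, by the push-through identity. -/
lemma smul_inv_mulVec_eq_residual {m r : Type*} [Fintype m] [DecidableEq m] [Fintype r]
    [DecidableEq r] (F : Matrix m r ℝ) {c : ℝ} (hc : 0 < c) (p : m → ℝ) (w : r → ℝ)
    (hw : c • w = Fᵀ *ᵥ (p - F *ᵥ w)) :
    c • ((c • (1 : Matrix m m ℝ) + F * Fᵀ)⁻¹ *ᵥ p) = p - F *ᵥ w := by
  have hM : (c • (1 : Matrix m m ℝ) + F * Fᵀ).PosDef :=
    posDef_smul_one_add hc (by simpa using posSemidef_self_mul_conjTranspose F)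
  have key : (c • (1 : Matrix m m ℝ) + F * Fᵀ) *ᵥ (p - F *ᵥ w) = c • p := by
    rw [add_mulVec, smul_mulVec, one_mulVec, ← mulVec_mulVec, ← hw, mulVec_smul, smul_sub]
    abel
  rw [← mulVec_smul, ← key, mulVec_mulVec,
    nonsing_inv_mul _ ((isUnit_iff_isUnit_det _).mp hM.isUnit), one_mulVec]

theorem stmt13 (q n s r : ℕ) (hq : 0 < q) (hn : 0 < n) (hs : 0 < s) (hr : 0 < r)
    (z : Fin q → ℝ) (xbar : Fin n → ℝ) (u : Fin s → ℝ)
    (Gs : Matrix (Fin q) (Fin n) ℝ) (Hs : Matrix (Fin q) (Fin s) ℝ)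
    (Fs : Matrix (Fin q) (Fin r) ℝ)
    (α σω σν : ℝ) (hα : 0 < α) (hσω : 0 < σω) (hσν : 0 < σν) :
    let α₁ : ℝ := α * σν ^ 2
    let α₂ : ℝ := σν ^ 2 / σω ^ 2
    let Γs : Matrix (Fin n) (Fin q) ℝ :=
      α₂ • (Gsᵀ * (α₂ • (1 : Matrix (Fin q) (Fin q) ℝ) + Fs * Fsᵀ)⁻¹)
    let Λs : Matrix (Fin n) (Fin n) ℝ := (α₁ • (1 : Matrix (Fin n) (Fin n) ℝ) + Γs * Gs)⁻¹
    let J : (Fin n → ℝ) → (Fin r → ℝ) → ℝ := fun x w =>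
      α * vecNorm (x - xbar) ^ 2 + σω⁻¹ ^ 2 * vecNorm w ^ 2 +
        σν⁻¹ ^ 2 * vecNorm (z - Gs.mulVec x - Hs.mulVec u - Fs.mulVec w) ^ 2
    let xhat : Fin n → ℝ := Λs.mulVec (α₁ • xbar + Γs.mulVec (z - Hs.mulVec u))
    let what : Fin r → ℝ :=
      ((α₂ • (1 : Matrix (Fin r) (Fin r) ℝ) + Fsᵀ * Fs)⁻¹ * Fsᵀ).mulVec
        (z - Hs.mulVec u - Gs.mulVec xhat)
    -- `(xhat, what)` is the unique global minimizer of `J`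
    (∀ (x : Fin n → ℝ) (w : Fin r → ℝ), J xhat what ≤ J x w) ∧
    (∀ (x : Fin n → ℝ) (w : Fin r → ℝ), J x w = J xhat what → x = xhat ∧ w = what) := by
  intro α₁ α₂ Γs Λs J xhat what
  have hα₁ : 0 < α₁ := by positivity
  have hα₂ : 0 < α₂ := by positivity
  have hN : (α₂ • (1 : Matrix (Fin r) (Fin r) ℝ) + Fsᵀ * Fs).PosDef :=
    posDef_smul_one_add hα₂ (by simpa using posSemidef_conjTranspose_mul_self Fs)
  have hM : (α₂ • (1 : Matrix (Fin q) (Fin q) ℝ) + Fs * Fsᵀ).PosDef :=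
    posDef_smul_one_add hα₂ (by simpa using posSemidef_self_mul_conjTranspose Fs)
  have hL : (α₁ • (1 : Matrix (Fin n) (Fin n) ℝ) + Γs * Gs).PosDef := by
    refine posDef_smul_one_add hα₁ ?_
    have h := (hM.inv.posSemidef.conjTranspose_mul_mul_same Gs).smul hα₂.le
    simpa [Γs] using h
  have hw : α₂ • what = Fsᵀ *ᵥ (z - Hs *ᵥ u - Gs *ᵥ xhat - Fs *ᵥ what) := by
    have h : (α₂ • (1 : Matrix (Fin r) (Fin r) ℝ) + Fsᵀ * Fs) *ᵥ what =
        Fsᵀ *ᵥ (z - Hs *ᵥ u - Gs *ᵥ xhat) := by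
      simp only [what]
      rw [← mulVec_mulVec, hN.mul_inv_mulVec]
    rw [add_mulVec, smul_mulVec, one_mulVec, ← mulVec_mulVec] at h
    rw [mulVec_sub _ _ (Fs *ᵥ what), ← h, add_sub_cancel_right]
  have hx : α₁ • (xhat - xbar) = Gsᵀ *ᵥ (z - Hs *ᵥ u - Gs *ᵥ xhat - Fs *ᵥ what) := by
    have h : (α₁ • (1 : Matrix (Fin n) (Fin n) ℝ) + Γs * Gs) *ᵥ xhat =
        α₁ • xbar + Γs *ᵥ (z - Hs *ᵥ u) := hL.mul_inv_mulVec _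
    rw [add_mulVec, smul_mulVec, one_mulVec, ← mulVec_mulVec] at h
    have hΓ : Γs *ᵥ (z - Hs *ᵥ u - Gs *ᵥ xhat) =
        Gsᵀ *ᵥ (z - Hs *ᵥ u - Gs *ᵥ xhat - Fs *ᵥ what) := by
      rw [← smul_inv_mulVec_eq_residual Fs hα₂ _ _ hw, mulVec_smul]
      simp only [Γs]
      rw [smul_mulVec, ← mulVec_mulVec]
    rw [← hΓ, mulVec_sub, smul_sub, sub_eq_sub_iff_add_eq_add, h, add_comm]
  have hJ : ∀ x w, J x w = J xhat what + (α * vecNorm (x - xhat) ^ 2 +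
      σω⁻¹ ^ 2 * vecNorm (w - what) ^ 2 +
      σν⁻¹ ^ 2 * vecNorm (-(Gs *ᵥ (x - xhat) + Fs *ᵥ (w - what))) ^ 2) := by
    intro x w
    simp only [J, sub_right_comm z _ (Hs *ᵥ u)]
    refine cost_eq_of_normal_equations Gs Fs _ xbar xhat x what w α _ _ ?_ ?_
    · rw [← hx, smul_smul]
      congr 1
      simp only [α₁]
      field_simp
    · rw [← hw, smul_smul]
      congr 1
      simp only [α₂]
      field_simp
  refine ⟨fun x w => ?_, fun x w h => ?_⟩
  · rw [hJ x w]
    exact le_add_of_nonneg_right (by positivity)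
  · rw [hJ x w, add_eq_left] at h
    have hb : 0 < σω⁻¹ ^ 2 := by positivity
    have h₁ : 0 ≤ α * vecNorm (x - xhat) ^ 2 := by positivity
    have h₂ : 0 ≤ σω⁻¹ ^ 2 * vecNorm (w - what) ^ 2 := by positivity
    have h₃ : 0 ≤ σν⁻¹ ^ 2 * vecNorm (-(Gs *ᵥ (x - xhat) + Fs *ᵥ (w - what))) ^ 2 := by
      positivity
    have hx₀ : α * vecNorm (x - xhat) ^ 2 = 0 := by linarith
    have hw₀ : σω⁻¹ ^ 2 * vecNorm (w - what) ^ 2 = 0 := by linarith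
    exact ⟨sub_eq_zero.mp (vecNorm_sq_eq_zero.mp ((mul_eq_zero_iff_left hα.ne').mp hx₀)),
      sub_eq_zero.mp (vecNorm_sq_eq_zero.mp ((mul_eq_zero_iff_left hb.ne').mp hw₀))⟩
end
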